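/- Let Γ be a countable amenable group and α an action of Γ by homeomorphisms on a nonempty compact Hausdorff 0-dimensional space X. Then α has dynamical comparison if and only if for every order unit b ∈ T(α), every a ∈ T(α), and every n ∈ ℕ such that (n+1)a ≤ nb, one has a ≤ b. -/

import Mathlib

open MeasureTheory Set
open scoped ENNReal

/-! Preliminary definitions: the clopen type semigroup of an action of a group `Γ`
by homeomorphisms on a topological space `X`, invariant measures, dynamical comparison,
topological full groups, and the topology on spaces of actions. -/

/-- The group of self-homeomorphisms of `X`, with `(g * h) x = g (h x)`. -/
instance homeoGroup (X : Type*) [TopologicalSpace X] : Group (X ≃ₜ X) where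
  mul g h := h.trans g
  one := Homeomorph.refl X
  inv := Homeomorph.symm
  mul_assoc a b c := Homeomorph.ext fun _ => rfl
  one_mul a := Homeomorph.ext fun _ => rfl
  mul_one a := Homeomorph.ext fun _ => rfl
  inv_mul_cancel a := Homeomorph.ext fun x => a.symm_apply_apply x

/-- The Cantor space `{0,1}^ℕ`. -/
abbrev Cantor : Type := ℕ → Bool

section Defs

variable {Γ : Type*} [Group Γ] {X : Type*} [TopologicalSpace X]

/-- A left-invariant finitely additive probability measure on (the power set of) `Γ`,
with values in `[0,1]`. `Γ` is amenable iff such a measure exists. -/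
def IsInvFapm {Γ : Type*} [Group Γ] (m : Set Γ → ℝ) : Prop :=
  (∀ E : Set Γ, 0 ≤ m E) ∧ (∀ E : Set Γ, m E ≤ 1) ∧ m Set.univ = 1 ∧
  (∀ E F : Set Γ, Disjoint E F → m (E ∪ F) = m E + m F) ∧
  (∀ (γ : Γ) (E : Set Γ), m ((γ * ·) '' E) = m E)

/-- The action of `γ ∈ Γ` on continuous `ℕ`-valued functions: `(γ · f)(x) = f(γ⁻¹ · x)`. -/
def actC (α : Γ →* X ≃ₜ X) (γ : Γ) (f : C(X, ℕ)) : C(X, ℕ) :=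
  f.comp (α γ⁻¹)

/-- The equidecomposability relation `∼` on `C(X, ℕ)`: `f ∼ g` iff `f = h₁ + ⋯ + hₙ`
and `g = γ₁·h₁ + ⋯ + γₙ·hₙ` for some `hᵢ ∈ C(X,ℕ)`, `γᵢ ∈ Γ`. -/
def TypeRel (α : Γ →* X ≃ₜ X) (f g : C(X, ℕ)) : Prop :=
  ∃ (n : ℕ) (h : Fin n → C(X, ℕ)) (γ : Fin n → Γ),
    f = ∑ i, h i ∧ g = ∑ i, actC α (γ i) (h i)

/-- The additive congruence on `C(X, ℕ)` generated by `∼` (since `∼` is itself an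
additive congruence, this is just `∼`). -/
def typeCon (α : Γ →* X ≃ₜ X) : AddCon C(X, ℕ) := addConGen (TypeRel α)

/-- The clopen type semigroup `T(α) = C(X,ℕ)/∼`. -/
abbrev TypeSemigroup (α : Γ →* X ≃ₜ X) := (typeCon α).Quotient

/-- The class `[f] ∈ T(α)` of `f ∈ C(X, ℕ)`. -/
def cls (α : Γ →* X ≃ₜ X) (f : C(X, ℕ)) : TypeSemigroup α := (typeCon α).toQuotient f

/-- The algebraic preorder on `T(α)`: `a ≤ b` iff `a + c = b` for some `c`. -/
def tle (α : Γ →* X ≃ₜ X) (a b : TypeSemigroup α) : Prop := ∃ c, a + c = b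

/-- `T(α)` is unperforated: `n • a ≤ n • b` implies `a ≤ b` for all `n ≥ 1`. -/
def IsUnperforated (α : Γ →* X ≃ₜ X) : Prop :=
  ∀ (a b : TypeSemigroup α) (n : ℕ), 1 ≤ n → tle α (n • a) (n • b) → tle α a b

/-- `T(α)` is almost unperforated: `(n+1) • a ≤ n • b` implies `a ≤ b`. -/
def IsAlmostUnperforated (α : Γ →* X ≃ₜ X) : Prop :=
  ∀ (a b : TypeSemigroup α) (n : ℕ), tle α ((n + 1) • a) (n • b) → tle α a b

/-- `T(α)` is cancellative: `a + b = a + c` implies `b = c`. -/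
def IsCancellative (α : Γ →* X ≃ₜ X) : Prop :=
  ∀ a b c : TypeSemigroup α, a + b = a + c → b = c

/-- The algebraic preorder on `T(α)` is a partial order, i.e. it is antisymmetric. -/
def TleAntisymm (α : Γ →* X ≃ₜ X) : Prop :=
  ∀ a b : TypeSemigroup α, tle α a b → tle α b a → a = b

/-- `b` is an order unit of `T(α)`: every `a` satisfies `a ≤ k • b` for some `k ∈ ℕ`. -/
def IsOrderUnit (α : Γ →* X ≃ₜ X) (b : TypeSemigroup α) : Prop :=
  ∀ a : TypeSemigroup α, ∃ k : ℕ, tle α a (k • b)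

/-- A state on `T(α)`: an additive map to `[0,∞]` sending `0` to `0`. -/
def IsState (α : Γ →* X ≃ₜ X) (ν : TypeSemigroup α → ℝ≥0∞) : Prop :=
  ν 0 = 0 ∧ ∀ a b : TypeSemigroup α, ν (a + b) = ν a + ν b

/-- `M(α)`: the set of `Γ`-invariant Radon (regular Borel) probability measures on `X`. -/
def invRadon (α : Γ →* X ≃ₜ X) : Set (@Measure X (borel X)) :=
  letI : MeasurableSpace X := borel X
  {μ : Measure X | IsProbabilityMeasure μ ∧ μ.Regular ∧ ∀ γ : Γ, Measure.map ⇑(α γ) μ = μ}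

/-- The set of `Γ`-invariant Borel probability measures on `X`. -/
def invBorel (α : Γ →* X ≃ₜ X) : Set (@Measure X (borel X)) :=
  letI : MeasurableSpace X := borel X
  {μ : Measure X | IsProbabilityMeasure μ ∧ ∀ γ : Γ, Measure.map ⇑(α γ) μ = μ}

/-- `μ([f]) = ∫ f dμ`, the value of (the state associated with) a measure on the class of
`f ∈ C(X, ℕ)`. -/
noncomputable def intOf {X : Type*} [TopologicalSpace X] (μ : @Measure X (borel X))
    (f : C(X, ℕ)) : ℝ :=
  letI : MeasurableSpace X := borel X
  ∫ x, (f x : ℝ) ∂μ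

/-- `A` is subequidecomposable to `B`: there are a partition `A = A₁ ⊔ ⋯ ⊔ Aₙ` into clopen
sets and `γ₁, …, γₙ ∈ Γ` with `γ₁A₁, …, γₙAₙ` pairwise disjoint and contained in `B`. -/
def Subequidecomposable (α : Γ →* X ≃ₜ X) (A B : Set X) : Prop :=
  ∃ (n : ℕ) (P : Fin n → Set X) (γ : Fin n → Γ),
    (∀ i, IsClopen (P i)) ∧ (Pairwise fun i j => Disjoint (P i) (P j)) ∧
    (⋃ i, P i) = A ∧
    (Pairwise fun i j => Disjoint (⇑(α (γ i)) '' P i) (⇑(α (γ j)) '' P j)) ∧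
    ∀ i, ⇑(α (γ i)) '' P i ⊆ B

/-- Dynamical comparison (with respect to invariant Radon probability measures): for all
clopen `A`, `B` with `B` nonempty and `μ(A) < μ(B)` for every `μ ∈ M(α)`, `A` is
subequidecomposable to `B`. -/
def DynComparison (α : Γ →* X ≃ₜ X) : Prop :=
  ∀ A B : Set X, IsClopen A → IsClopen B → B.Nonempty →
    (∀ μ ∈ invRadon α, μ A < μ B) → Subequidecomposable α A B

/-- Dynamical comparison (with respect to invariant Borel probability measures). -/
def DynComparisonBorel (α : Γ →* X ≃ₜ X) : Prop :=
  ∀ A B : Set X, IsClopen A → IsClopen B → B.Nonempty →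
    (∀ μ ∈ invBorel α, μ A < μ B) → Subequidecomposable α A B

/-- The action `α` is minimal: the only closed invariant subsets are `∅` and `X`. -/
def IsMinimalAction (α : Γ →* X ≃ₜ X) : Prop :=
  ∀ F : Set X, IsClosed F → (∀ γ : Γ, ⇑(α γ) '' F ⊆ F) → F = ∅ ∨ F = Set.univ

/-- Membership in the topological full group `⟦α⟧`: `g` coincides with elements of the
action on the pieces of a finite clopen partition of `X`. -/
def InTopFullGroup (α : Γ →* X ≃ₜ X) (g : X ≃ₜ X) : Prop :=
  ∃ (n : ℕ) (P : Fin n → Set X) (γ : Fin n → Γ),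
    (∀ i, IsClopen (P i)) ∧ (Pairwise fun i j => Disjoint (P i) (P j)) ∧
    (⋃ i, P i) = Set.univ ∧ ∀ i, ∀ x ∈ P i, g x = α (γ i) x

/-- `⟦α⟧` admits a dense locally finite subgroup: there is a subgroup `Λ` of `Homeo(X)`
contained in `⟦α⟧`, locally finite (all its finitely generated subgroups are finite), and
dense in `⟦α⟧` for the topology whose basic neighborhoods of `h` are
`{g : g A = h A for all A ∈ 𝒜}`, `𝒜` ranging over finite clopen partitions of `X`. -/
def HasDenseLocallyFiniteSubgroup (α : Γ →* X ≃ₜ X) : Prop :=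
  ∃ Λ : Subgroup (X ≃ₜ X),
    ((Λ : Set (X ≃ₜ X)) ⊆ {g | InTopFullGroup α g}) ∧
    (∀ s : Finset (X ≃ₜ X), (s : Set (X ≃ₜ X)) ⊆ (Λ : Set (X ≃ₜ X)) →
      ((Subgroup.closure (s : Set (X ≃ₜ X)) : Subgroup (X ≃ₜ X)) : Set (X ≃ₜ X)).Finite) ∧
    ∀ g : X ≃ₜ X, InTopFullGroup α g →
      ∀ (n : ℕ) (P : Fin n → Set X), (∀ i, IsClopen (P i)) →
        (Pairwise fun i j => Disjoint (P i) (P j)) → (⋃ i, P i) = Set.univ →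
        ∃ l ∈ Λ, ∀ i, ⇑l '' P i = ⇑g '' P i

end Defs

/-- The topology on `Homeo(X)` whose basic neighborhoods of `h` are the sets
`{g : g A = h A for all A ∈ 𝒜}`, for `𝒜` a finite clopen partition of `X`; equivalently,
the topology generated by the sets `{g : g '' A = B}` for `A`, `B` clopen. -/
def homeoTop (X : Type*) [TopologicalSpace X] : TopologicalSpace (X ≃ₜ X) :=
  TopologicalSpace.generateFrom
    {U | ∃ A B : Set X, IsClopen A ∧ IsClopen B ∧ U = {g : X ≃ₜ X | ⇑g '' A = B}}

/-- The topology on the space `A(Γ)` of actions of `Γ` on `X`, induced from the product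
topology on `Homeo(X)^Γ`. -/
def actionTop (Γ : Type*) [Group Γ] (X : Type*) [TopologicalSpace X] :
    TopologicalSpace (Γ →* (X ≃ₜ X)) :=
  letI := homeoTop X
  TopologicalSpace.induced (fun φ : Γ →* (X ≃ₜ X) => ⇑φ) Pi.topologicalSpace


section Part1
variable {Γ : Type*} [Group Γ] {X : Type*} [TopologicalSpace X]

theorem act_mul' (α : Γ →* X ≃ₜ X) (γ δ : Γ) (x : X) : α (γ * δ) x = α γ (α δ x) := by
  rw [map_mul]; rfl

theorem act_one' (α : Γ →* X ≃ₜ X) (x : X) : α 1 x = x := by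
  rw [map_one]; rfl

theorem act_inv_act (α : Γ →* X ≃ₜ X) (γ : Γ) (x : X) : α γ⁻¹ (α γ x) = x := by
  rw [← act_mul', inv_mul_cancel, act_one']

theorem act_act_inv (α : Γ →* X ≃ₜ X) (γ : Γ) (x : X) : α γ (α γ⁻¹ x) = x := by
  rw [← act_mul', mul_inv_cancel, act_one']

theorem actC_apply (α : Γ →* X ≃ₜ X) (γ : Γ) (f : C(X, ℕ)) (x : X) :
    actC α γ f x = f (α γ⁻¹ x) := rfl

theorem actC_add (α : Γ →* X ≃ₜ X) (γ : Γ) (f g : C(X, ℕ)) :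
    actC α γ (f + g) = actC α γ f + actC α γ g := by
  ext x; simp [actC_apply]

theorem actC_zero (α : Γ →* X ≃ₜ X) (γ : Γ) : actC α γ 0 = 0 := by
  ext x; simp [actC_apply]

theorem actC_mul (α : Γ →* X ≃ₜ X) (γ δ : Γ) (f : C(X, ℕ)) :
    actC α (γ * δ) f = actC α γ (actC α δ f) := by
  ext x; simp only [actC_apply, mul_inv_rev, act_mul']

theorem actC_one (α : Γ →* X ≃ₜ X) (f : C(X, ℕ)) : actC α 1 f = f := by
  ext x; simp only [actC_apply, inv_one, act_one']

/-- inductive form of the equidecomposability relation -/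
inductive RR (α : Γ →* X ≃ₜ X) : C(X, ℕ) → C(X, ℕ) → Prop
  | zero : RR α 0 0
  | step (f g h : C(X, ℕ)) (γ : Γ) : RR α f g → RR α (f + h) (g + actC α γ h)

theorem RR.single (α : Γ →* X ≃ₜ X) (γ : Γ) (h : C(X, ℕ)) : RR α h (actC α γ h) := by
  simpa using RR.step 0 0 h γ RR.zero

theorem RR.refl (α : Γ →* X ≃ₜ X) (h : C(X, ℕ)) : RR α h h := by
  simpa [actC_one] using RR.single α 1 h

theorem RR.add {α : Γ →* X ≃ₜ X} {f g f' g' : C(X, ℕ)} (h : RR α f g) (h' : RR α f' g') :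
    RR α (f + f') (g + g') := by
  induction h' with
  | zero => simpa using h
  | step f₁ g₁ k γ _ ih => simpa [add_assoc] using RR.step _ _ k γ ih

theorem RR.symm {α : Γ →* X ≃ₜ X} {f g : C(X, ℕ)} (h : RR α f g) : RR α g f := by
  induction h with
  | zero => exact RR.zero
  | step f₁ g₁ k γ _ ih =>
    have := RR.step _ _ (actC α γ k) γ⁻¹ ih
    rwa [← actC_mul, inv_mul_cancel, actC_one] at this

theorem RR.act {α : Γ →* X ≃ₜ X} {f g : C(X, ℕ)} (h : RR α f g) (δ : Γ) :
    RR α (actC α δ f) g := by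
  induction h with
  | zero => rw [actC_zero]; exact RR.zero
  | step f₁ g₁ k γ _ ih =>
    have := RR.step _ _ (actC α δ k) (γ * δ⁻¹) ih
    rwa [← actC_mul, inv_mul_cancel_right, ← actC_add] at this

/-- pointwise minimum -/
def cmin (f g : C(X, ℕ)) : C(X, ℕ) :=
  ⟨fun x => min (f x) (g x), by fun_prop⟩

/-- truncated subtraction -/
def csub (f g : C(X, ℕ)) : C(X, ℕ) :=
  ⟨fun x => f x - g x,
    (continuous_of_discreteTopology (f := fun p : ℕ × ℕ => p.1 - p.2)).comp
      (f.continuous.prodMk g.continuous)⟩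

theorem cmin_apply (f g : C(X, ℕ)) (x : X) : cmin f g x = min (f x) (g x) := rfl
theorem csub_apply (f g : C(X, ℕ)) (x : X) : csub f g x = f x - g x := rfl

theorem csub_add {f g : C(X, ℕ)} (h : ∀ x, g x ≤ f x) : f = csub f g + g := by
  ext x
  have := h x
  simp only [ContinuousMap.add_apply, csub_apply]; omega

theorem refine22 {f₁ f₂ f h : C(X, ℕ)} (e : f₁ + f₂ = f + h) :
    ∃ a b c d : C(X, ℕ), f₁ = a + b ∧ f₂ = c + d ∧ f = a + c ∧ h = b + d := by
  have e' : ∀ x, f₁ x + f₂ x = f x + h x := fun x => by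
    simpa using DFunLike.congr_fun e x
  refine ⟨cmin f₁ f, csub f₁ (cmin f₁ f), csub f (cmin f₁ f),
    csub h (csub f₁ (cmin f₁ f)), ?_, ?_, ?_, ?_⟩ <;> ext x <;>
    have := e' x <;> simp only [ContinuousMap.add_apply, csub_apply, cmin_apply] <;> omega

theorem RR.split {α : Γ →* X ≃ₜ X} {f g : C(X, ℕ)} (h : RR α f g) :
    ∀ f₁ f₂, f₁ + f₂ = f → ∃ g₁ g₂, g = g₁ + g₂ ∧ RR α f₁ g₁ ∧ RR α f₂ g₂ := by
  induction h with
  | zero =>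
    intro f₁ f₂ e
    have e' : ∀ x, f₁ x + f₂ x = 0 := fun x => by simpa using DFunLike.congr_fun e x
    have h1 : f₁ = 0 := by ext x; have := e' x; simp only [ContinuousMap.zero_apply]; omega
    have h2 : f₂ = 0 := by ext x; have := e' x; simp only [ContinuousMap.zero_apply]; omega
    subst h1 h2
    exact ⟨0, 0, by simp, RR.zero, RR.zero⟩
  | step f g k γ _ ih =>
    intro f₁ f₂ e
    obtain ⟨a, b, c, d, rfl, rfl, rfl, rfl⟩ := refine22 e
    obtain ⟨g₁, g₂, rfl, r1, r2⟩ := ih a c rfl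
    refine ⟨g₁ + actC α γ b, g₂ + actC α γ d, ?_, RR.step _ _ _ _ r1, RR.step _ _ _ _ r2⟩
    rw [actC_add]; abel

theorem RR.trans {α : Γ →* X ≃ₜ X} {f g : C(X, ℕ)} (h : RR α f g) :
    ∀ l, RR α g l → RR α f l := by
  induction h with
  | zero => exact fun l h => h
  | step f g k γ _ ih =>
    intro l hl
    obtain ⟨l₁, l₂, rfl, r1, r2⟩ := hl.split _ _ rfl
    refine (ih _ r1).add ?_
    have := r2.act γ⁻¹
    rwa [← actC_mul, inv_mul_cancel, actC_one] at this

theorem RR.of_sum (α : Γ →* X ≃ₜ X) (n : ℕ) (h : Fin n → C(X, ℕ)) (γ : Fin n → Γ) :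
    RR α (∑ i, h i) (∑ i, actC α (γ i) (h i)) := by
  induction n with
  | zero => simpa using RR.zero
  | succ n ih =>
    rw [Fin.sum_univ_castSucc, Fin.sum_univ_castSucc]
    exact RR.step _ _ _ _ (ih _ _)

theorem RR.toTypeRel {α : Γ →* X ≃ₜ X} {f g : C(X, ℕ)} (h : RR α f g) : TypeRel α f g := by
  induction h with
  | zero => exact ⟨0, fun _ => 0, fun _ => 1, by simp, by simp⟩
  | step f g k γ _ ih =>
    obtain ⟨n, h, δ, rfl, rfl⟩ := ih
    refine ⟨n + 1, Fin.snoc h k, Fin.snoc δ γ, ?_, ?_⟩ <;>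
    simp [Fin.sum_univ_castSucc]

/-- `RR` as a congruence -/
def rrCon (α : Γ →* X ≃ₜ X) : AddCon C(X, ℕ) where
  r := RR α
  iseqv := ⟨RR.refl α, fun h => h.symm, fun h h' => h.trans _ h'⟩
  add' h h' := h.add h'

theorem typeCon_eq (α : Γ →* X ≃ₜ X) : typeCon α = rrCon α := by
  apply le_antisymm
  · apply AddCon.addConGen_le.2
    rintro f g ⟨n, h, γ, rfl, rfl⟩
    exact RR.of_sum α n h γ
  · intro f g h
    exact AddConGen.Rel.of _ _ (RR.toTypeRel h)

theorem cls_eq_iff (α : Γ →* X ≃ₜ X) (f g : C(X, ℕ)) : cls α f = cls α g ↔ RR α f g := by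
  have : cls α f = cls α g ↔ typeCon α f g := (typeCon α).eq
  rw [this, typeCon_eq]; rfl

theorem cls_add (α : Γ →* X ≃ₜ X) (f g : C(X, ℕ)) : cls α (f + g) = cls α f + cls α g := rfl

theorem cls_surj (α : Γ →* X ≃ₜ X) (a : TypeSemigroup α) : ∃ f, cls α f = a :=
  AddCon.induction_on a fun f => ⟨f, rfl⟩

theorem cls_nsmul (α : Γ →* X ≃ₜ X) (n : ℕ) (f : C(X, ℕ)) : cls α (n • f) = n • cls α f := rfl

theorem tle_iff (α : Γ →* X ≃ₜ X) (f g : C(X, ℕ)) :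
    tle α (cls α f) (cls α g) ↔ ∃ g₁ g₂, g = g₁ + g₂ ∧ RR α f g₁ := by
  constructor
  · rintro ⟨c, hc⟩
    obtain ⟨c, rfl⟩ := cls_surj α c
    rw [← cls_add, cls_eq_iff] at hc
    obtain ⟨g₁, g₂, e, r1, _⟩ := hc.split _ _ rfl
    exact ⟨g₁, g₂, e, r1⟩
  · rintro ⟨g₁, g₂, rfl, r⟩
    exact ⟨cls α g₂, by rw [cls_add, (cls_eq_iff α f g₁).2 r]⟩

theorem tle_trans' {α : Γ →* X ≃ₜ X} {a b c : TypeSemigroup α} (h : tle α a b) (h' : tle α b c) :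
    tle α a c := by
  obtain ⟨d, rfl⟩ := h
  obtain ⟨e, rfl⟩ := h'
  exact ⟨d + e, by rw [add_assoc]⟩

theorem tle_refl' {α : Γ →* X ≃ₜ X} (a : TypeSemigroup α) : tle α a a := ⟨0, add_zero a⟩

theorem tle_add' {α : Γ →* X ≃ₜ X} {a b c d : TypeSemigroup α} (h : tle α a b) (h' : tle α c d) :
    tle α (a + c) (b + d) := by
  obtain ⟨e, rfl⟩ := h
  obtain ⟨e', rfl⟩ := h'
  exact ⟨e + e', by abel⟩

theorem tle_nsmul' {α : Γ →* X ≃ₜ X} {a b : TypeSemigroup α} (h : tle α a b) (n : ℕ) :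
    tle α (n • a) (n • b) := by
  obtain ⟨e, rfl⟩ := h
  exact ⟨n • e, by rw [nsmul_add]⟩

theorem tle_of_le {α : Γ →* X ≃ₜ X} {f g : C(X, ℕ)} (h : ∀ x, f x ≤ g x) :
    tle α (cls α f) (cls α g) :=
  ⟨cls α (csub g f), by rw [← cls_add, add_comm, ← csub_add h]⟩

/-- indicator of a clopen set -/
noncomputable def ind (A : Set X) (hA : IsClopen A) : C(X, ℕ) :=
  ⟨A.indicator 1, continuous_one.indicator (by simp [hA.frontier_eq])⟩

theorem ind_mem {A : Set X} (hA : IsClopen A) {x : X} (hx : x ∈ A) : ind A hA x = 1 := by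
  simp [ind, hx]

theorem ind_not_mem {A : Set X} (hA : IsClopen A) {x : X} (hx : x ∉ A) : ind A hA x = 0 := by
  simp [ind, hx]

/-- the set where a function is positive -/
def pos (f : C(X, ℕ)) : Set X := {x | 1 ≤ f x}

theorem pos_clopen (f : C(X, ℕ)) : IsClopen (pos f) :=
  (isClopen_discrete {n : ℕ | 1 ≤ n}).preimage f.continuous

theorem image_act (α : Γ →* X ≃ₜ X) (γ : Γ) (A : Set X) (x : X) :
    x ∈ ⇑(α γ) '' A ↔ α γ⁻¹ x ∈ A := by
  constructor
  · rintro ⟨y, hy, rfl⟩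
    rwa [act_inv_act]
  · intro h
    exact ⟨_, h, act_act_inv α γ x⟩

theorem subequi_iff (α : Γ →* X ≃ₜ X) {A B : Set X} (hA : IsClopen A) (hB : IsClopen B) :
    Subequidecomposable α A B ↔ tle α (cls α (ind A hA)) (cls α (ind B hB)) := by
  classical
  rw [tle_iff]
  constructor
  · rintro ⟨n, P, γ, hP, hd, rfl, hd', hsub⟩
    refine ⟨∑ i, actC α (γ i) (ind (P i) (hP i)),
      csub (ind B hB) (∑ i, actC α (γ i) (ind (P i) (hP i))), ?_, ?_⟩
    · rw [add_comm]
      apply csub_add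
      intro x
      rw [ContinuousMap.sum_apply]
      by_cases h : ∃ i, α (γ i)⁻¹ x ∈ P i
      · obtain ⟨i, hi⟩ := h
        have hxi := (image_act α (γ i) (P i) x).2 hi
        rw [Finset.sum_eq_single i, actC_apply, ind_mem _ hi, ind_mem _ (hsub i hxi)]
        · intro j _ hj
          rw [actC_apply, ind_not_mem]
          intro h2
          exact Set.disjoint_left.1 (hd' hj) ((image_act α (γ j) (P j) x).2 h2) hxi
        · simp
      · push Not at h
        rw [Finset.sum_eq_zero]
        · exact Nat.zero_le _
        · intro i _
          rw [actC_apply, ind_not_mem _ (h i)]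
    · convert RR.of_sum α n (fun i => ind (P i) (hP i)) γ
      ext x
      rw [ContinuousMap.sum_apply]
      by_cases h : ∃ i, x ∈ P i
      · obtain ⟨i, hi⟩ := h
        rw [ind_mem _ (Set.mem_iUnion.2 ⟨i, hi⟩), Finset.sum_eq_single i, ind_mem _ hi]
        · intro j _ hj
          rw [ind_not_mem]
          intro h2
          exact Set.disjoint_left.1 (hd hj) h2 hi
        · simp
      · rw [ind_not_mem _ (by simpa using h), Finset.sum_eq_zero]
        push Not at h
        intro i _
        rw [ind_not_mem _ (h i)]
  · rintro ⟨g₁, g₂, e, r⟩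
    obtain ⟨n, h, γ, e1, rfl⟩ := r.toTypeRel
    have key : ∀ (u : Fin n → ℕ), ∑ i, u i ≤ 1 → ∀ i j, i ≠ j → 1 ≤ u i → 1 ≤ u j → False := by
      intro u hu i j hij hi hj
      have : ∑ k ∈ {i, j}, u k ≤ ∑ k, u k :=
        Finset.sum_le_sum_of_subset (Finset.subset_univ _)
      rw [Finset.sum_pair hij] at this
      omega
    have hle : ∀ (C : Set X) (hC : IsClopen C) x, ind C hC x ≤ 1 := by
      intro C hC x
      by_cases hx : x ∈ C
      · rw [ind_mem _ hx]
      · rw [ind_not_mem _ hx]; omega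
    have e1' : ∀ x, ind A hA x = ∑ i, h i x := fun x => by rw [e1, ContinuousMap.sum_apply]
    have e2' : ∀ x, ind B hB x = ∑ i, h i (α (γ i)⁻¹ x) + g₂ x := fun x => by
      rw [e, ContinuousMap.add_apply, ContinuousMap.sum_apply]; rfl
    refine ⟨n, fun i => pos (h i), γ, fun i => pos_clopen _, ?_, ?_, ?_, ?_⟩
    · intro i j hij
      rw [Set.disjoint_left]
      intro x hi hj
      exact key (fun i => h i x) (by rw [← e1']; exact hle _ _ _) i j hij hi hj
    · ext x
      rw [Set.mem_iUnion]
      constructor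
      · rintro ⟨i, hi⟩
        by_contra hx
        have h1 := e1' x
        rw [ind_not_mem _ hx] at h1
        have h2 := Finset.single_le_sum (f := fun i => h i x) (fun i _ => Nat.zero_le _)
          (Finset.mem_univ i)
        have h3 : 1 ≤ h i x := hi
        omega
      · intro hx
        have h1 := e1' x
        rw [ind_mem _ hx] at h1
        by_contra hc
        push Not at hc
        rw [Finset.sum_eq_zero] at h1
        · omega
        · intro i _
          have : ¬ 1 ≤ h i x := hc i
          omega
    · intro i j hij
      rw [Set.disjoint_left]
      intro x hi hj
      rw [image_act] at hi hj
      refine key (fun i => h i (α (γ i)⁻¹ x)) ?_ i j hij hi hj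
      have := e2' x
      have := hle B hB x
      omega
    · intro i x hi
      rw [image_act] at hi
      by_contra hx
      have h1 := e2' x
      rw [ind_not_mem _ hx] at h1
      have h2 := Finset.single_le_sum (f := fun i => h i (α (γ i)⁻¹ x)) (fun i _ => Nat.zero_le _)
          (Finset.mem_univ i)
      have h3 : 1 ≤ h i (α (γ i)⁻¹ x) := hi
      omega

end Part1

set_option linter.unusedSectionVars false
section Part2
variable {Γ : Type*} [Group Γ] {X : Type*} [TopologicalSpace X] [CompactSpace X] [T2Space X]
    [TotallyDisconnectedSpace X]

/-- a finitely additive probability on clopen sets, invariant under the action -/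
structure FinAdd (α : Γ →* X ≃ₜ X) (c : Set X → ℝ) : Prop where
  nonneg : ∀ A, IsClopen A → 0 ≤ c A
  add : ∀ A B, IsClopen A → IsClopen B → Disjoint A B → c (A ∪ B) = c A + c B
  univ : c Set.univ = 1
  inv : ∀ γ A, IsClopen A → c (⇑(α γ) '' A) = c A

theorem image_clopen (α : Γ →* X ≃ₜ X) (γ : Γ) {A : Set X} (hA : IsClopen A) :
    IsClopen (⇑(α γ) '' A) :=
  ⟨(α γ).isClosedMap _ hA.1, (α γ).isOpenMap _ hA.2⟩

theorem FinAdd.mono {α : Γ →* X ≃ₜ X} {c : Set X → ℝ} (hc : FinAdd α c) {A B : Set X}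
    (hA : IsClopen A) (hB : IsClopen B) (h : A ⊆ B) : c A ≤ c B := by
  have := hc.add A (B \ A) hA (hB.diff hA) Set.disjoint_sdiff_right
  rw [Set.union_sdiff_cancel h] at this
  have := hc.nonneg _ (hB.diff hA)
  linarith

theorem FinAdd.union_le {α : Γ →* X ≃ₜ X} {c : Set X → ℝ} (hc : FinAdd α c) {A B : Set X}
    (hA : IsClopen A) (hB : IsClopen B) : c (A ∪ B) ≤ c A + c B := by
  have h1 := hc.add A (B \ A) hA (hB.diff hA) Set.disjoint_sdiff_right
  rw [Set.union_sdiff_self] at h1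
  have := hc.mono (hB.diff hA) hB Set.sdiff_subset
  linarith

/-- value on a compact set -/
noncomputable def cval (c : Set X → ℝ) (K : Set X) : ℝ :=
  sInf (c '' {A | IsClopen A ∧ K ⊆ A})

theorem cval_le {α : Γ →* X ≃ₜ X} {c : Set X → ℝ} (hc : FinAdd α c) {K A : Set X}
    (hA : IsClopen A) (h : K ⊆ A) : cval c K ≤ c A := by
  refine csInf_le ⟨0, ?_⟩ ⟨A, ⟨hA, h⟩, rfl⟩
  rintro _ ⟨B, ⟨hB, _⟩, rfl⟩
  exact hc.nonneg B hB

theorem le_cval {c : Set X → ℝ} {K : Set X} {r : ℝ}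
    (h : ∀ A, IsClopen A → K ⊆ A → r ≤ c A) : r ≤ cval c K := by
  refine le_csInf ⟨_, Set.univ, ⟨isClopen_univ, Set.subset_univ _⟩, rfl⟩ ?_
  rintro _ ⟨B, ⟨hB, hK⟩, rfl⟩
  exact h B hB hK

theorem cval_nonneg {α : Γ →* X ≃ₜ X} {c : Set X → ℝ} (hc : FinAdd α c) (K : Set X) :
    0 ≤ cval c K := le_cval fun A hA _ => hc.nonneg A hA

theorem cval_clopen {α : Γ →* X ≃ₜ X} {c : Set X → ℝ} (hc : FinAdd α c) {A : Set X}
    (hA : IsClopen A) : cval c A = c A :=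
  le_antisymm (cval_le hc hA subset_rfl) (le_cval fun _ hB h => hc.mono hA hB h)

theorem cval_mono {α : Γ →* X ≃ₜ X} {c : Set X → ℝ} (hc : FinAdd α c) {K L : Set X}
    (h : K ⊆ L) : cval c K ≤ cval c L :=
  le_cval fun _ hA hL => cval_le hc hA (h.trans hL)

theorem cval_union_le {α : Γ →* X ≃ₜ X} {c : Set X → ℝ} (hc : FinAdd α c) (K L : Set X) :
    cval c (K ∪ L) ≤ cval c K + cval c L := by
  have : cval c (K ∪ L) - cval c L ≤ cval c K := le_cval fun A hA hK => by
    have : cval c (K ∪ L) - c A ≤ cval c L := le_cval fun B hB hL => by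
      have h1 := cval_le hc (hA.union hB) (Set.union_subset_union hK hL)
      have h2 := hc.union_le hA hB
      linarith
    linarith
  linarith

theorem cval_union {α : Γ →* X ≃ₜ X} {c : Set X → ℝ} (hc : FinAdd α c) {K L : Set X}
    (hK : IsClosed K) (hL : IsClosed L) (hd : Disjoint K L) :
    cval c (K ∪ L) = cval c K + cval c L := by
  refine le_antisymm (cval_union_le hc K L) (le_cval fun A hA hKL => ?_)
  obtain ⟨C, hC, hKC, hCL⟩ := exists_clopen_of_closed_subset_open hK hL.isOpen_compl
    (Set.disjoint_left.1 hd)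
  have h1 := cval_le hc (hA.inter hC) (K := K)
    (Set.subset_inter (Set.subset_union_left.trans hKL) hKC)
  have h2 := cval_le hc (hA.diff hC) (K := L)
    (fun x hx => ⟨hKL (Or.inr hx), fun h => hCL h hx⟩)
  have h3 := hc.add _ _ (hA.inter hC) (hA.diff hC) (Set.disjoint_left.2 fun x h h' => h'.2 h.2)
  rw [Set.inter_union_sdiff] at h3
  linarith

theorem cval_image {α : Γ →* X ≃ₜ X} {c : Set X → ℝ} (hc : FinAdd α c) (γ : Γ) (K : Set X) :
    cval c (⇑(α γ) '' K) = cval c K := by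
  have key : ∀ (γ : Γ) (K : Set X), cval c (⇑(α γ) '' K) ≤ cval c K := by
    intro γ K
    refine le_cval fun A hA h => ?_
    rw [← hc.inv γ A hA]
    exact cval_le hc (image_clopen α γ hA) (Set.image_mono h)
  refine le_antisymm (key γ K) ?_
  have := key γ⁻¹ (⇑(α γ) '' K)
  rw [Set.image_image] at this
  simpa only [act_inv_act, Set.image_id'] using this

/-- the content attached to a finitely additive probability -/
noncomputable def finContent {α : Γ →* X ≃ₜ X} {c : Set X → ℝ} (hc : FinAdd α c) : Content X where
  toFun K := (cval c (K : Set X)).toNNReal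
  mono' _ _ h := Real.toNNReal_mono (cval_mono hc h)
  sup_disjoint' K L h h1 h2 := by
    rw [← Real.toNNReal_add (cval_nonneg hc _) (cval_nonneg hc _), ← cval_union hc h1 h2 h]; rfl
  sup_le' K L := by
    rw [← Real.toNNReal_add (cval_nonneg hc _) (cval_nonneg hc _)]
    exact Real.toNNReal_mono (cval_union_le hc K L)

theorem exists_measure {α : Γ →* X ≃ₜ X} {c : Set X → ℝ} (hc : FinAdd α c) :
    ∃ μ ∈ invRadon α, ∀ A, IsClopen A → μ A = ENNReal.ofReal (c A) := by
  let : MeasurableSpace X := borel X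
  have : BorelSpace X := ⟨rfl⟩
  have hval : ∀ A, IsClopen A → (finContent hc).measure A = ENNReal.ofReal (c A) := by
    intro A hA
    rw [Content.measure_apply _ hA.isOpen.measurableSet, Content.outerMeasure_of_isOpen _ _ hA.isOpen,
      Content.innerContent_of_isCompact _ hA.isClosed.isCompact hA.isOpen]
    change ENNReal.ofReal (cval c A) = _
    rw [cval_clopen hc hA]
  refine ⟨(finContent hc).measure, ⟨⟨?_⟩, inferInstance, ?_⟩, hval⟩
  · rw [hval _ isClopen_univ, hc.univ, ENNReal.ofReal_one]
  · intro γ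
    ext A hA
    rw [Measure.map_apply (α γ).continuous.measurable hA, Content.measure_apply _ hA,
      Content.measure_apply _ ((α γ).continuous.measurable hA)]
    apply Content.outerMeasure_preimage
    intro K
    change ENNReal.ofReal (cval c _) = ENNReal.ofReal (cval c _)
    congr 1
    exact cval_image hc γ K

theorem mean_finAdd (α : Γ →* X ≃ₜ X) {m : Set Γ → ℝ} (hm : IsInvFapm m) (x : X) :
    FinAdd α (fun A => m {γ | α γ x ∈ A}) := by
  obtain ⟨h0, h1, hu, hadd, hinv⟩ := hm
  refine ⟨fun A _ => h0 _, ?_, ?_, ?_⟩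
  · intro A B _ _ hd
    rw [← hadd]
    · rfl
    · rw [Set.disjoint_left]
      intro γ ha hb
      exact Set.disjoint_left.1 hd ha hb
  · simpa using hu
  · intro γ A _
    rw [← hinv γ {δ | α δ x ∈ A}]
    congr 1
    ext δ
    rw [Set.mem_ofPred_eq, image_act, ← act_mul']
    simp only [Set.mem_image, Set.mem_ofPred_eq]
    constructor
    · intro h
      exact ⟨_, h, by group⟩
    · rintro ⟨ε, h, rfl⟩
      simpa using h

/-- Dini type lemma -/
theorem uniform_small (α : Γ →* X ≃ₜ X) (A : ℕ → Set X) (hA : ∀ n, IsClopen (A n))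
    (hanti : Antitone A) (hz : ∀ μ ∈ invRadon α, μ (⋂ n, A n) = 0) {ε : ℝ} (hε : 0 < ε) :
    ∃ n, ∀ μ ∈ invRadon α, μ (A n) < ENNReal.ofReal ε := by
  let : MeasurableSpace X := borel X
  have : BorelSpace X := ⟨rfl⟩
  by_contra hcon
  push Not at hcon
  choose μ hμ hge using hcon
  let U : Ultrafilter ℕ := Ultrafilter.of Filter.atTop
  have hU : (U : Filter ℕ) ≤ Filter.atTop := Ultrafilter.of_le _
  have : ∀ n, IsProbabilityMeasure (μ n) := fun n => (hμ n).1
  have hlim : ∀ B : Set X, ∃ r : ℝ, Filter.Tendsto (fun n => (μ n).real B) U (nhds r) := by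
    intro B
    have hc : IsCompact (Set.Icc (0 : ℝ) 1) := isCompact_Icc
    obtain ⟨r, _, hr⟩ := hc.ultrafilter_le_nhds (U.map fun n => (μ n).real B) (by
      rw [Filter.le_principal_iff]
      exact Filter.mem_map.2 <| Filter.Eventually.of_forall (f := (U : Filter ℕ)) fun n => ⟨measureReal_nonneg, measureReal_le_one⟩)
    exact ⟨r, hr⟩
  choose c hcl using hlim
  have hc : FinAdd α c := by
    refine ⟨?_, ?_, ?_, ?_⟩
    · intro B _
      exact ge_of_tendsto' (hcl B) fun n => measureReal_nonneg
    · intro B C hB hC hd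
      refine tendsto_nhds_unique (hcl _) (((hcl B).add (hcl C)).congr fun n => ?_)
      rw [measureReal_union hd hC.isOpen.measurableSet]
    · refine tendsto_nhds_unique (hcl _) (tendsto_const_nhds.congr fun n => ?_)
      simp
    · intro γ B hB
      refine tendsto_nhds_unique (hcl _) ((hcl B).congr fun n => ?_)
      have h1 : Measure.map (α γ) (μ n) = μ n := (hμ n).2.2 γ
      have h2 : MeasurableSet (⇑(α γ) '' B) := (image_clopen α γ hB).isOpen.measurableSet
      conv_rhs => rw [← h1]
      rw [map_measureReal_apply (α γ).continuous.measurable h2,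
        Set.preimage_image_eq _ (α γ).injective]
  obtain ⟨ν, hν, hνc⟩ := exists_measure hc
  have : IsProbabilityMeasure ν := hν.1
  have h1 : ∀ n, ENNReal.ofReal ε ≤ ν (A n) := by
    intro n
    rw [hνc _ (hA n)]
    apply ENNReal.ofReal_le_ofReal
    refine ge_of_tendsto (hcl (A n)) (hU ?_)
    filter_upwards [Filter.eventually_ge_atTop n] with j hj
    have h2 := (hge j).trans (measure_mono (hanti hj))
    exact (ENNReal.ofReal_le_iff_le_toReal (measure_ne_top _ _)).1 h2
  have h2 : Filter.Tendsto (fun n => ν (A n)) Filter.atTop (nhds (ν (⋂ n, A n))) :=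
    tendsto_measure_iInter_atTop (fun n => (hA n).isOpen.measurableSet.nullMeasurableSet) hanti
      ⟨0, measure_ne_top _ _⟩
  have h3 := ge_of_tendsto' h2 h1
  rw [hz ν hν] at h3
  simp at h3
  linarith

end Part2

set_option linter.unusedSectionVars false
section Part3
variable {Γ : Type*} [Group Γ] {X : Type*} [TopologicalSpace X] [CompactSpace X]

theorem nsmul_ap (n : ℕ) (v : C(X, ℝ)) (x : X) : (n • v) x = (n : ℝ) * v x := by
  rw [ContinuousMap.nsmul_apply, nsmul_eq_mul]

/-- closed cone approximated by `V` plus nonnegative functions -/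
noncomputable def coneOf (V : AddSubmonoid C(X, ℝ)) : PointedCone ℝ C(X, ℝ) where
  carrier := {h | ∀ ε : ℝ, 0 < ε → ∃ N : ℕ, 0 < N ∧ ∃ v ∈ V, ∀ x, v x ≤ N * (h x + ε)}
  zero_mem' := by
    intro ε hε
    refine ⟨1, one_pos, 0, V.zero_mem, fun x => ?_⟩
    simp [hε.le]
  add_mem' := by
    intro a b ha hb ε hε
    obtain ⟨N, hN, v, hv, h⟩ := ha (ε / 2) (by linarith)
    obtain ⟨N', hN', v', hv', h'⟩ := hb (ε / 2) (by linarith)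
    refine ⟨N * N', Nat.mul_pos hN hN', N' • v + N • v',
      V.add_mem (V.nsmul_mem hv _) (V.nsmul_mem hv' _), fun x => ?_⟩
    have h1 := mul_le_mul_of_nonneg_left (h x) (Nat.cast_nonneg (α := ℝ) N')
    have h2 := mul_le_mul_of_nonneg_left (h' x) (Nat.cast_nonneg (α := ℝ) N)
    rw [ContinuousMap.add_apply, ContinuousMap.add_apply, nsmul_ap, nsmul_ap]
    push_cast
    nlinarith
  smul_mem' := by
    rintro ⟨c, hc⟩ h hh ε hε
    obtain ⟨N, hN, v, hv, hvx⟩ := hh (ε / (2 * (c + 1))) (by positivity)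
    obtain ⟨D, hD⟩ := exists_nat_gt (2 * ‖v‖ / ε)
    have hD0 : (0 : ℝ) < D := lt_of_le_of_lt (by positivity) hD
    refine ⟨N * D, Nat.mul_pos hN (by exact_mod_cast hD0), ⌊D * c⌋₊ • v, V.nsmul_mem hv _, ?_⟩
    intro x
    have hN1 : (1 : ℝ) ≤ N := by exact_mod_cast hN
    have e1 : c * (ε / (2 * (c + 1))) ≤ ε / 2 := by
      rw [mul_div_assoc', div_le_div_iff₀ (by positivity) (by positivity)]
      nlinarith
    rw [div_lt_iff₀ hε] at hD
    have hDc : 0 ≤ D * c := by positivity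
    have f1 := Nat.floor_le hDc
    have f2 := Nat.lt_floor_add_one (D * c)
    have hb : |v x| ≤ ‖v‖ := v.norm_coe_le_norm x
    have hb' := abs_le.1 hb
    have h1 := mul_le_mul_of_nonneg_left (hvx x) hDc
    have h2 : -(((D * c) - ⌊D * c⌋₊) * v x) ≤ ‖v‖ := by
      have : |((D * c) - ⌊D * c⌋₊) * v x| ≤ 1 * ‖v‖ := by
        rw [abs_mul]
        apply mul_le_mul _ hb (abs_nonneg _) zero_le_one
        rw [abs_le]; constructor <;> linarith
      have := (abs_le.1 this).1
      linarith
    have h3 : (D : ℝ) * ε ≤ N * (D * ε) := le_mul_of_one_le_left (by positivity) hN1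
    have h4 := mul_le_mul_of_nonneg_left e1 (show (0 : ℝ) ≤ N * D by positivity)
    have e2 : ((⟨c, hc⟩ : {c : ℝ // 0 ≤ c}) • h) x = c * h x := rfl
    rw [e2, nsmul_ap]
    push_cast
    nlinarith

theorem exists_functional [Nonempty X] (V : AddSubmonoid C(X, ℝ)) (hno : ∀ v ∈ V, ∃ x, 0 ≤ v x) :
    ∃ g : C(X, ℝ) →ₗ[ℝ] ℝ, g 1 = 1 ∧ (∀ h : C(X, ℝ), (∀ x, 0 ≤ h x) → 0 ≤ g h) ∧
      ∀ v ∈ V, 0 ≤ g v := by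
  have h10 : (1 : C(X, ℝ)) ≠ 0 := one_ne_zero
  obtain ⟨g, hg1, hg2⟩ := riesz_extension (coneOf V) (LinearPMap.mkSpanSingleton 1 (1 : ℝ) h10)
    (by
      rintro ⟨y, hy⟩ hs
      obtain ⟨t, rfl⟩ := Submodule.mem_span_singleton.1 hy
      refine le_of_le_of_eq ?_ (LinearPMap.mkSpanSingleton'_apply (1 : C(X, ℝ)) (1 : ℝ) _ t hy).symm
      simp only [smul_eq_mul, mul_one, RingHom.id_apply]
      by_contra ht
      push Not at ht
      obtain ⟨N, hN, v, hv, h⟩ := hs (-t / 2) (by linarith)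
      obtain ⟨x, hx⟩ := hno v hv
      have h1 := h x
      have hN' : (0 : ℝ) < N := by exact_mod_cast hN
      simp at h1
      nlinarith)
    (by
      intro y
      refine ⟨⟨‖y‖ • 1, Submodule.mem_span_singleton.2 ⟨_, rfl⟩⟩, ?_⟩
      intro ε hε
      refine ⟨1, one_pos, 0, V.zero_mem, fun x => ?_⟩
      have := (abs_le.1 (y.norm_coe_le_norm x)).1
      simp
      linarith)
  refine ⟨g, ?_, ?_, ?_⟩
  · have := hg1 ⟨1, Submodule.mem_span_singleton_self _⟩
    rw [LinearPMap.mkSpanSingleton_apply] at this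
    simpa using this
  · intro h hh
    apply hg2
    intro ε hε
    refine ⟨1, one_pos, 0, V.zero_mem, fun x => ?_⟩
    have := hh x
    simp
    linarith
  · intro v hv
    apply hg2
    intro ε hε
    refine ⟨1, one_pos, v, hv, fun x => ?_⟩
    simp [hε.le]

/-- cast to real valued functions -/
def toR : C(X, ℕ) →+ C(X, ℝ) where
  toFun f := ⟨fun x => (f x : ℝ), continuous_of_discreteTopology.comp f.continuous⟩
  map_zero' := by ext x; simp
  map_add' f g := by ext x; simp

theorem toR_apply (f : C(X, ℕ)) (x : X) : toR f x = (f x : ℝ) := rfl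

/-- the monoid of differences -/
def VV (α : Γ →* X ≃ₜ X) (a b : C(X, ℕ)) : AddSubmonoid C(X, ℝ) where
  carrier := {v | ∃ (k : ℕ) (p q : C(X, ℕ)), RR α p q ∧ v = toR (k • a + p) - toR (k • b + q)}
  zero_mem' := ⟨0, 0, 0, RR.zero, by simp⟩
  add_mem' := by
    rintro _ _ ⟨k, p, q, h, rfl⟩ ⟨k', p', q', h', rfl⟩
    refine ⟨k + k', p + p', q + q', h.add h', ?_⟩
    simp only [map_add, add_nsmul]
    abel

theorem ind_union {A B : Set X} (hA : IsClopen A) (hB : IsClopen B) (hd : Disjoint A B) :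
    ind (A ∪ B) (hA.union hB) = ind A hA + ind B hB := by
  ext x
  rw [ContinuousMap.add_apply]
  by_cases h1 : x ∈ A
  · rw [ind_mem _ (Set.mem_union_left B h1), ind_mem _ h1, ind_not_mem _ (Set.disjoint_left.1 hd h1)]
  · by_cases h2 : x ∈ B
    · rw [ind_mem _ (Set.mem_union_right A h2), ind_mem _ h2, ind_not_mem _ h1]
    · rw [ind_not_mem, ind_not_mem _ h1, ind_not_mem _ h2]
      rintro (h | h) <;> contradiction

theorem ind_image (α : Γ →* X ≃ₜ X) (γ : Γ) {A : Set X} (hA : IsClopen A)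
    (h : IsClopen (⇑(α γ) '' A)) : ind _ h = actC α γ (ind A hA) := by
  ext x
  rw [actC_apply]
  by_cases hx : α γ⁻¹ x ∈ A
  · rw [ind_mem _ hx, ind_mem]
    rwa [image_act]
  · rw [ind_not_mem _ hx, ind_not_mem]
    rwa [image_act]

theorem hahn_banach [T2Space X] [TotallyDisconnectedSpace X] [Nonempty X] (α : Γ →* X ≃ₜ X)
    {A B : Set X} (hA : IsClopen A) (hB : IsClopen B) (h : ∀ μ ∈ invRadon α, μ A < μ B) :
    ∃ (k : ℕ) (p q : C(X, ℕ)), RR α p q ∧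
      ∀ x, (k • ind A hA + p + 1) x ≤ (k • ind B hB + q) x := by
  classical
  by_contra hcon
  push Not at hcon
  obtain ⟨g, g1, gpos, gV⟩ := exists_functional (VV α (ind A hA) (ind B hB)) (by
    rintro _ ⟨k, p, q, r, rfl⟩
    obtain ⟨x, hx⟩ := hcon k p q r
    refine ⟨x, ?_⟩
    have hx' : (k • ind B hB + q) x ≤ (k • ind A hA + p) x := by
      rw [ContinuousMap.add_apply _ 1, ContinuousMap.one_apply] at hx
      omega
    rw [ContinuousMap.sub_apply, toR_apply, toR_apply, sub_nonneg]
    exact_mod_cast hx')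
  have hle : ∀ p q, RR α p q → g (toR q) ≤ g (toR p) := by
    intro p q r
    have := gV (toR p - toR q) ⟨0, p, q, r, by simp⟩
    rw [map_sub] at this
    linarith
  let c : Set X → ℝ := fun C => if hC : IsClopen C then g (toR (ind C hC)) else 0
  have hcC : ∀ C (hC : IsClopen C), c C = g (toR (ind C hC)) := fun C hC => dif_pos hC
  have hc : FinAdd α c := by
    refine ⟨?_, ?_, ?_, ?_⟩
    · intro C hC
      rw [hcC C hC]
      exact gpos _ fun x => Nat.cast_nonneg _
    · intro C D hC hD hd
      rw [hcC C hC, hcC D hD, hcC _ (hC.union hD), ind_union hC hD hd, map_add, map_add]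
    · rw [hcC _ isClopen_univ, ← g1]
      congr 1
      ext x
      rw [toR_apply, ind_mem _ (Set.mem_univ x)]
      simp
    · intro γ C hC
      rw [hcC _ hC, hcC _ (image_clopen α γ hC), ind_image α γ hC]
      have r := RR.single α γ (ind C hC)
      exact le_antisymm (hle _ _ r) (hle _ _ r.symm)
  obtain ⟨μ, hμ, hμc⟩ := exists_measure hc
  have h1 := h μ hμ
  rw [hμc A hA, hμc B hB, hcC A hA, hcC B hB] at h1
  have h2 := (ENNReal.ofReal_lt_ofReal_iff_of_nonneg (gpos _ fun x => Nat.cast_nonneg _)).1 h1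
  have h3 := gV _ ⟨1, 0, 0, RR.zero, rfl⟩
  simp only [one_smul, add_zero, map_sub] at h3
  linarith

theorem comparison_of_unperf [T2Space X] [TotallyDisconnectedSpace X] [Nonempty X]
    (hamen : ∃ m : Set Γ → ℝ, IsInvFapm m) (α : Γ →* (X ≃ₜ X))
    (H : ∀ b : TypeSemigroup α, IsOrderUnit α b →
        ∀ (a : TypeSemigroup α) (n : ℕ), tle α ((n + 1) • a) (n • b) → tle α a b) :
    DynComparison α := by
  intro A B hA hB hBne hlt
  obtain ⟨m, hm⟩ := hamen
  -- translates of B cover X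
  have hcov : ∀ x : X, ∃ γ : Γ, α γ x ∈ B := by
    intro x
    by_contra hx
    push Not at hx
    obtain ⟨μ, hμ, hμc⟩ := exists_measure (mean_finAdd α hm x)
    have h1 := hlt μ hμ
    rw [hμc B hB] at h1
    have : {γ | α γ x ∈ B} = (∅ : Set Γ) := by
      ext γ; simpa using hx γ
    rw [this] at h1
    have h2 := hm.2.2.2.1 ∅ ∅ (by simp)
    simp only [Set.union_empty] at h2
    have h3 : m ∅ = 0 := by linarith
    rw [h3] at h1
    simp at h1
  have hunit1 : ∃ L : ℕ, tle α (cls α 1) (L • cls α (ind B hB)) := by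
    obtain ⟨t, ht⟩ := isCompact_univ.elim_finite_subcover (fun γ : Γ => ⇑(α γ) ⁻¹' B)
      (fun γ => hB.isOpen.preimage (α γ).continuous)
      (fun x _ => Set.mem_iUnion.2 (hcov x))
    refine ⟨t.card, ?_⟩
    have h1 : cls α (∑ γ ∈ t, actC α γ⁻¹ (ind B hB)) = t.card • cls α (ind B hB) := by
      clear ht
      classical
      induction t using Finset.induction_on with
      | empty => simp; rfl
      | insert γ s hs ih =>
        rw [Finset.sum_insert hs, Finset.card_insert_of_notMem hs, cls_add, ih, add_nsmul, one_nsmul,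
          add_comm]
        congr 1
        rw [cls_eq_iff]
        exact (RR.single α γ⁻¹ _).symm
    rw [← h1]
    apply tle_of_le
    intro x
    obtain ⟨γ, hγ, hx⟩ := Set.mem_iUnion₂.1 (ht (Set.mem_univ x))
    rw [ContinuousMap.sum_apply]
    have h2 := Finset.single_le_sum (f := fun γ => actC α γ⁻¹ (ind B hB) x)
      (fun i _ => Nat.zero_le _) hγ
    refine le_trans ?_ h2
    simp only [actC_apply, inv_inv]
    rw [ind_mem hB (x := α γ x) hx]
    simp
  have hunit : IsOrderUnit α (cls α (ind B hB)) := by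
    intro a
    obtain ⟨f, rfl⟩ := cls_surj α a
    obtain ⟨L, hL⟩ := hunit1
    obtain ⟨M, hM⟩ : ∃ M : ℕ, ∀ x, f x ≤ M := by
      obtain ⟨M, hM⟩ := (isCompact_range f.continuous).bddAbove
      exact ⟨M, fun x => hM ⟨x, rfl⟩⟩
    refine ⟨M * L, ?_⟩
    rw [mul_nsmul']
    refine tle_trans' ?_ (tle_nsmul' hL M)
    rw [← cls_nsmul]
    apply tle_of_le
    intro x
    simpa using hM x
  rw [subequi_iff α hA hB]
  obtain ⟨k, p, q, r, hkpq⟩ := hahn_banach α hA hB hlt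
  have h1 := tle_of_le (α := α) hkpq
  rw [cls_add, cls_add, cls_add, cls_nsmul, cls_nsmul, ← (cls_eq_iff α p q).2 r] at h1
  have hau : tle α (cls α (ind A hA)) (cls α 1) := by
    apply tle_of_le
    intro x
    by_cases hx : x ∈ A
    · rw [ind_mem _ hx]; simp
    · rw [ind_not_mem _ hx]; simp
  generalize cls α (ind A hA) = a at *
  generalize cls α (ind B hB) = b at *
  generalize cls α p = P at *
  have h2 : tle α (k • a + P + a) (k • b + P) := tle_trans' (tle_add' (tle_refl' _) hau) h1
  have h3 : ∀ j : ℕ, tle α ((j * k + j) • a + P) ((j * k) • b + P) := by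
    intro j
    induction j with
    | zero => simpa using tle_refl' P
    | succ j ih =>
      have e1 : ((j + 1) * k + (j + 1)) • a + P = (j * k + j) • a + P + (k • a + a) := by
        rw [show (j + 1) * k + (j + 1) = (j * k + j) + (k + 1) by ring, add_nsmul,
          add_nsmul a k 1, one_nsmul]
        abel
      have e2 : ((j + 1) * k) • b + P = (j * k) • b + (k • b + P) := by
        rw [show (j + 1) * k = j * k + k by ring, add_nsmul, add_assoc]
      rw [e1, e2]
      refine tle_trans' (tle_add' ih (tle_refl' _)) ?_
      have e3 : (j * k) • b + P + (k • a + a) = (j * k) • b + (k • a + P + a) := by abel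
      rw [e3]
      exact tle_add' (tle_refl' _) h2
  obtain ⟨L, hL⟩ := hunit P
  refine H b hunit a ((L + 1) * k + L) ?_
  rw [add_assoc, add_nsmul b ((L + 1) * k) L]
  refine tle_trans' ⟨P, rfl⟩ (tle_trans' (h3 (L + 1)) (tle_add' (tle_refl' _) hL))

end Part3

set_option linter.unusedSectionVars false
section Part4
variable {Γ : Type*} [Group Γ] {X : Type*} [TopologicalSpace X] [CompactSpace X]

/-- finite invariant measures -/
def InvM [MeasurableSpace X] (α : Γ →* X ≃ₜ X) (ν : Measure X) : Prop :=
  IsFiniteMeasure ν ∧ ∀ γ : Γ, Measure.map ⇑(α γ) ν = ν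

/-- the integral -/
noncomputable def II [MeasurableSpace X] (ν : Measure X) (f : C(X, ℕ)) : ℝ := ∫ x, (f x : ℝ) ∂ν

section meas
variable [MeasurableSpace X] [BorelSpace X]

theorem cont_cast (f : C(X, ℕ)) : Continuous fun x => (f x : ℝ) :=
  continuous_of_discreteTopology.comp f.continuous

theorem integ (ν : Measure X) [IsFiniteMeasure ν] (f : C(X, ℕ)) :
    Integrable (fun x => (f x : ℝ)) ν :=
  (cont_cast f).integrable_of_hasCompactSupport (HasCompactSupport.of_compactSpace _)

theorem II_add (ν : Measure X) [IsFiniteMeasure ν] (f g : C(X, ℕ)) :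
    II ν (f + g) = II ν f + II ν g := by
  unfold II
  rw [← integral_add (integ ν f) (integ ν g)]
  simp

theorem II_zero (ν : Measure X) : II ν (0 : C(X, ℕ)) = 0 := by
  simp [II]

theorem II_nsmul (ν : Measure X) [IsFiniteMeasure ν] (n : ℕ) (f : C(X, ℕ)) :
    II ν (n • f) = n * II ν f := by
  induction n with
  | zero => simp [II_zero]
  | succ n ih => rw [add_nsmul, II_add, ih, one_nsmul]; push_cast; ring

theorem II_nonneg (ν : Measure X) (f : C(X, ℕ)) : 0 ≤ II ν f :=
  integral_nonneg fun _ => Nat.cast_nonneg _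

theorem II_mono (ν : Measure X) [IsFiniteMeasure ν] {f g : C(X, ℕ)} (h : ∀ x, f x ≤ g x) :
    II ν f ≤ II ν g :=
  integral_mono (integ ν f) (integ ν g) fun x => Nat.cast_le.2 (h x)

theorem II_ind (ν : Measure X) {A : Set X} (hA : IsClopen A) :
    II ν (ind A hA) = ν.real A := by
  have : (fun x => (ind A hA x : ℝ)) = A.indicator 1 := by
    ext x
    by_cases hx : x ∈ A
    · rw [ind_mem _ hx]; simp [hx]
    · rw [ind_not_mem _ hx]; simp [hx]
  unfold II
  rw [this, integral_indicator_one hA.isOpen.measurableSet]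

theorem II_act {α : Γ →* X ≃ₜ X} {ν : Measure X} (hν : InvM α ν) (γ : Γ) (f : C(X, ℕ)) :
    II ν (actC α γ f) = II ν f := by
  unfold II
  conv_rhs => rw [← hν.2 γ⁻¹]
  rw [integral_map (α γ⁻¹).continuous.measurable.aemeasurable
    (cont_cast f).measurable.aestronglyMeasurable]
  rfl

theorem II_RR {α : Γ →* X ≃ₜ X} {ν : Measure X} (hν : InvM α ν) {f g : C(X, ℕ)} (h : RR α f g) :
    II ν f = II ν g := by
  have := hν.1
  induction h with
  | zero => rfl
  | step f g k γ _ ih => rw [II_add, II_add, ih, II_act hν]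

theorem II_tle {α : Γ →* X ≃ₜ X} {ν : Measure X} (hν : InvM α ν) {f g : C(X, ℕ)}
    (h : tle α (cls α f) (cls α g)) : II ν f ≤ II ν g := by
  have := hν.1
  obtain ⟨g₁, g₂, rfl, r⟩ := (tle_iff α f g).1 h
  rw [II_add, II_RR hν r]
  have := II_nonneg ν g₂
  linarith

theorem bdd (f : C(X, ℕ)) : ∃ M : ℕ, ∀ x, f x ≤ M := by
  obtain ⟨M, hM⟩ := (isCompact_range f.continuous).bddAbove
  exact ⟨M, fun x => hM ⟨x, rfl⟩⟩

theorem le_ind_pos {f : C(X, ℕ)} {M : ℕ} (h : ∀ x, f x ≤ M) (x : X) :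
    f x ≤ (M • ind (pos f) (pos_clopen f)) x := by
  rw [ContinuousMap.nsmul_apply]
  by_cases hx : x ∈ pos f
  · rw [ind_mem _ hx]; simpa using h x
  · have : ¬ 1 ≤ f x := hx
    omega

theorem II_le_pos (ν : Measure X) [IsFiniteMeasure ν] {f : C(X, ℕ)} {M : ℕ} (h : ∀ x, f x ≤ M) :
    II ν f ≤ M * ν.real (pos f) := by
  rw [← II_ind ν (pos_clopen f), ← II_nsmul]
  exact II_mono ν (le_ind_pos h)

end meas

/-- one greedy step -/
def gstep (α : Γ →* X ≃ₜ X) (γ : Γ) (s : C(X, ℕ) × C(X, ℕ)) : C(X, ℕ) × C(X, ℕ) :=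
  (csub s.1 (cmin s.1 (actC α γ⁻¹ s.2)), csub s.2 (actC α γ (cmin s.1 (actC α γ⁻¹ s.2))))

theorem greedy [Countable Γ] (α : Γ →* X ≃ₜ X) (f g : C(X, ℕ)) :
    ∃ F G : ℕ → C(X, ℕ), (∀ n x, F (n + 1) x ≤ F n x) ∧ (∀ n x, G (n + 1) x ≤ G n x) ∧
      (∀ n, ∃ h h', f = F n + h ∧ g = G n + h' ∧ RR α h h') ∧
      ∀ γ : Γ, ∃ n, ∀ y, F n y = 0 ∨ G n (α γ y) = 0 := by
  obtain ⟨e, he⟩ := exists_surjective_nat Γ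
  let S : ℕ → C(X, ℕ) × C(X, ℕ) := fun n => Nat.rec (f, g) (fun n s => gstep α (e n) s) n
  have hS : ∀ n, S (n + 1) = gstep α (e n) (S n) := fun n => rfl
  refine ⟨fun n => (S n).1, fun n => (S n).2, ?_, ?_, ?_, ?_⟩
  · intro n x
    simp only [hS, gstep, csub_apply]
    omega
  · intro n x
    simp only [hS, gstep, csub_apply]
    omega
  · intro n
    induction n with
    | zero => exact ⟨0, 0, (add_zero f).symm, (add_zero g).symm, RR.zero⟩
    | succ n ih =>
      obtain ⟨h, h', e1, e2, r⟩ := ih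
      refine ⟨h + cmin (S n).1 (actC α (e n)⁻¹ (S n).2),
        h' + actC α (e n) (cmin (S n).1 (actC α (e n)⁻¹ (S n).2)), ?_, ?_, RR.step _ _ _ _ r⟩
      · conv_lhs => rw [e1]
        simp only [hS, gstep]
        conv_lhs => rw [csub_add (f := (S n).1) (g := cmin (S n).1 (actC α (e n)⁻¹ (S n).2))
          (fun x => by rw [cmin_apply]; omega)]
        abel
      · conv_lhs => rw [e2]
        simp only [hS, gstep]
        conv_lhs => rw [csub_add (f := (S n).2)
          (g := actC α (e n) (cmin (S n).1 (actC α (e n)⁻¹ (S n).2)))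
          (fun x => by
            rw [actC_apply, cmin_apply, actC_apply, inv_inv, act_act_inv]; omega)]
        abel
  · intro γ
    obtain ⟨n, rfl⟩ := he γ
    refine ⟨n + 1, fun y => ?_⟩
    simp only [hS, gstep, csub_apply, cmin_apply, actC_apply, inv_inv, act_inv_act]
    omega

theorem null_inter [Countable Γ] [MeasurableSpace X] [BorelSpace X] (α : Γ →* X ≃ₜ X)
    (f g : C(X, ℕ)) (F G : ℕ → C(X, ℕ))
    (hG : ∀ n x, G (n + 1) x ≤ G n x)
    (hdec : ∀ n, ∃ h h', f = F n + h ∧ g = G n + h' ∧ RR α h h')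
    (hd : ∀ γ : Γ, ∃ n, ∀ y, F n y = 0 ∨ G n (α γ y) = 0)
    {N k : ℕ} (h1 : ∀ ν : Measure X, InvM α ν → (N + 1) * II ν f ≤ N * II ν g)
    (h2 : ∀ ν : Measure X, InvM α ν → ν.real Set.univ ≤ k * II ν g)
    (μ : Measure X) (hμ : InvM α μ) : μ (⋂ n, pos (F n)) = 0 := by
  have := hμ.1
  set A := ⋂ n, pos (F n) with hA
  have hAm : MeasurableSet A := MeasurableSet.iInter fun n => (pos_clopen _).isOpen.measurableSet
  set Y : Set X := ⋃ γ : Γ, ⇑(α γ) ⁻¹' A with hY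
  have hYm : MeasurableSet Y := MeasurableSet.iUnion fun γ => (α γ).continuous.measurable hAm
  have hYinv : ∀ δ : Γ, ⇑(α δ) ⁻¹' Y = Y := by
    intro δ
    ext z
    simp only [hY, Set.mem_preimage, Set.mem_iUnion]
    constructor
    · rintro ⟨γ, h⟩
      exact ⟨γ * δ, by rwa [act_mul']⟩
    · rintro ⟨γ, h⟩
      refine ⟨γ * δ⁻¹, ?_⟩
      rwa [← act_mul', inv_mul_cancel_right]
  have hνinv : InvM α (μ.restrict Y) := by
    refine ⟨inferInstance, fun γ => ?_⟩
    have := Measure.restrict_map (μ := μ) (α γ).continuous.measurable hYm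
    rw [hYinv, hμ.2] at this
    exact this.symm
  set ν := μ.restrict Y with hν
  obtain ⟨M, hM⟩ := bdd g
  have hanti : Antitone fun n => pos (G n) :=
    antitone_nat_of_succ_le fun n x (hx : 1 ≤ G (n + 1) x) => le_trans hx (hG n x)
  have hlim : Filter.Tendsto (fun n => ν (pos (G n))) Filter.atTop (nhds 0) := by
    have : ν (⋂ n, pos (G n)) = 0 := by
      rw [hν, Measure.restrict_apply
        (MeasurableSet.iInter fun n => (pos_clopen _).isOpen.measurableSet)]
      convert measure_empty (μ := μ)
      ext z
      simp only [Set.mem_inter_iff, Set.mem_empty_iff_false, iff_false]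
      rintro ⟨hz, hzY⟩
      obtain ⟨γ, hγ⟩ := Set.mem_iUnion.1 hzY
      obtain ⟨n, hn⟩ := hd γ⁻¹
      have a1 : 1 ≤ F n (α γ z) := Set.mem_iInter.1 hγ n
      have a2 : 1 ≤ G n z := Set.mem_iInter.1 hz n
      have := hn (α γ z)
      rw [act_inv_act] at this
      omega
    rw [← this]
    exact tendsto_measure_iInter_atTop
      (fun n => (pos_clopen _).isOpen.measurableSet.nullMeasurableSet) hanti
      ⟨0, measure_ne_top _ _⟩
  have hlim' : Filter.Tendsto (fun n => (M : ℝ) * ν.real (pos (G n))) Filter.atTop (nhds 0) := by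
    have := (ENNReal.tendsto_toReal ENNReal.zero_ne_top).comp hlim
    simpa [Measure.real] using this.const_mul (M : ℝ)
  have hle : II ν g - II ν f ≤ 0 := by
    refine ge_of_tendsto' hlim' fun n => ?_
    obtain ⟨h, h', e1, e2, r⟩ := hdec n
    have hb : ∀ x, G n x ≤ M := fun x => by
      have := hM x
      rw [e2, ContinuousMap.add_apply] at this
      omega
    have b1 := II_le_pos ν hb
    have b2 := II_nonneg ν (F n)
    rw [e1, e2, II_add, II_add, II_RR hνinv r]
    linarith
  have c1 := h1 ν hνinv
  have c2 := h2 ν hνinv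
  have c3 := II_nonneg ν g
  have c4 : II ν g ≤ 0 := by
    have : (N : ℝ) * II ν g ≤ N * II ν f := mul_le_mul_of_nonneg_left (by linarith) (Nat.cast_nonneg _)
    linarith
  have c5 : II ν g = 0 := le_antisymm c4 c3
  rw [c5, mul_zero] at c2
  have c6 : ν.real Set.univ = 0 := le_antisymm c2 measureReal_nonneg
  rw [measureReal_eq_zero_iff, hν, Measure.restrict_apply_univ] at c6
  refine measure_mono_null ?_ c6
  intro x hx
  refine Set.mem_iUnion.2 ⟨1, ?_⟩
  rwa [Set.mem_preimage, act_one']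

theorem unperf_of_comparison [Countable Γ] [T2Space X] [TotallyDisconnectedSpace X] [Nonempty X]
    (hamen : ∃ m : Set Γ → ℝ, IsInvFapm m) (α : Γ →* (X ≃ₜ X)) (H : DynComparison α)
    (b : TypeSemigroup α) (hb : IsOrderUnit α b) (a : TypeSemigroup α) (N : ℕ)
    (hab : tle α ((N + 1) • a) (N • b)) : tle α a b := by
  let _ : MeasurableSpace X := borel X
  have : BorelSpace X := ⟨rfl⟩
  obtain ⟨f, rfl⟩ := cls_surj α a
  obtain ⟨g, rfl⟩ := cls_surj α b
  obtain ⟨k, hk⟩ := hb (cls α 1)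
  rw [← cls_nsmul] at hk
  rw [← cls_nsmul, ← cls_nsmul] at hab
  have h1 : ∀ ν : Measure X, InvM α ν → (N + 1) * II ν f ≤ N * II ν g := by
    intro ν hν
    have := hν.1
    have := II_tle hν hab
    rw [II_nsmul, II_nsmul] at this
    exact_mod_cast this
  have h2 : ∀ ν : Measure X, InvM α ν → ν.real Set.univ ≤ k * II ν g := by
    intro ν hν
    have := hν.1
    have := II_tle hν hk
    rw [II_nsmul] at this
    convert this
    simp [II]
  have hinvM : ∀ μ ∈ invRadon α, InvM α μ := by
    intro μ hμ
    have : IsProbabilityMeasure μ := hμ.1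
    exact ⟨inferInstance, hμ.2.2⟩
  obtain ⟨F, G, hF, hG, hdec, hd⟩ := greedy α f g
  obtain ⟨M₁, hM₁⟩ := bdd f
  obtain ⟨M₂, hM₂⟩ := bdd g
  set M := M₁ + M₂ + 1 with hM
  have hMpos : (0 : ℝ) < M := by positivity
  set δ : ℝ := 1 / ((k + 1) * (N + 1)) with hδ
  have hδpos : 0 < δ := by positivity
  have hgap : ∀ μ ∈ invRadon α, δ ≤ II μ g - II μ f := by
    intro μ hμ
    have : IsProbabilityMeasure μ := hμ.1
    have a1 := h1 μ (hinvM μ hμ)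
    have a2 := h2 μ (hinvM μ hμ)
    have a3 : μ.real Set.univ = 1 := by simp
    have a4 := II_nonneg μ g
    rw [a3] at a2
    rw [hδ, div_le_iff₀ (by positivity)]
    have a5 : II μ g ≤ (N + 1) * (II μ g - II μ f) := by linarith
    have a6 := mul_le_mul_of_nonneg_left a5 (show (0 : ℝ) ≤ k + 1 by positivity)
    nlinarith
  set ε : ℝ := δ / (2 * M) with hε
  have hεpos : 0 < ε := by positivity
  have hεM : (M + M) * ε = δ := by
    rw [hε]; field_simp; ring
  obtain ⟨n, hn⟩ := uniform_small α (fun n => pos (F n)) (fun n => pos_clopen _)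
    (antitone_nat_of_succ_le fun n x (hx : 1 ≤ F (n + 1) x) => le_trans hx (hF n x))
    (fun μ hμ => null_inter α f g F G hG hdec hd h1 h2 μ (hinvM μ hμ)) hεpos
  obtain ⟨h, h', e1, e2, r⟩ := hdec n
  have hFM : ∀ x, F n x ≤ M := fun x => by
    have := hM₁ x
    rw [e1, ContinuousMap.add_apply] at this
    omega
  have hGM : ∀ x, G n x ≤ M := fun x => by
    have := hM₂ x
    rw [e2, ContinuousMap.add_apply] at this
    omega
  -- an invariant measure exists
  obtain ⟨m, hm⟩ := hamen
  obtain ⟨x₀⟩ := ‹Nonempty X›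
  obtain ⟨μ₀, hμ₀, -⟩ := exists_measure (mean_finAdd α hm x₀)
  have key : ∀ (j : ℕ) (u : C(X, ℕ)), (∀ x, u x ≤ M) →
      (∀ μ ∈ invRadon α, (M + j) * ε ≤ II μ u) →
      tle α (cls α (j • ind (pos (F n)) (pos_clopen _))) (cls α u) := by
    intro j
    induction j with
    | zero =>
      intro u _ _
      apply tle_of_le
      intro x
      simp
    | succ j ih =>
      intro u hu hII
      have hpos : ∀ μ ∈ invRadon α, μ (pos (F n)) < μ (pos u) := by
        intro μ hμ
        have : IsProbabilityMeasure μ := hμ.1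
        refine lt_of_lt_of_le (hn μ hμ) ?_
        rw [ENNReal.ofReal_le_iff_le_toReal (measure_ne_top _ _)]
        have b1 := II_le_pos μ hu
        have b2 := hII μ hμ
        have b3 : (M : ℝ) * ε ≤ M * μ.real (pos u) := by
          have : 0 ≤ ((j + 1 : ℕ) : ℝ) * ε := by positivity
          linarith
        exact le_of_mul_le_mul_left b3 hMpos
      have hne : (pos u).Nonempty := by
        by_contra hcon
        rw [Set.not_nonempty_iff_eq_empty] at hcon
        have := hpos μ₀ hμ₀
        rw [hcon] at this
        simp at this
      have hsub := (subequi_iff α (pos_clopen (F n)) (pos_clopen u)).1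
        (H _ _ (pos_clopen _) (pos_clopen _) hne hpos)
      obtain ⟨g₁, g₂, e, r'⟩ := (tle_iff α _ _).1 hsub
      have hle : ∀ x, g₁ x ≤ u x := by
        intro x
        have ex : ind (pos u) (pos_clopen u) x = g₁ x + g₂ x := by rw [e]; rfl
        by_cases hx : x ∈ pos u
        · rw [ind_mem _ hx] at ex
          have : 1 ≤ u x := hx
          omega
        · rw [ind_not_mem _ hx] at ex
          omega
      have hu' := csub_add hle
      have ht := ih (csub u g₁) (fun x => by
        have := hu x
        rw [csub_apply]; omega) (by
        intro μ hμ
        have : IsProbabilityMeasure μ := hμ.1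
        have c1 := hII μ hμ
        rw [hu', II_add, ← II_RR (hinvM μ hμ) r', II_ind] at c1
        have c2 : μ.real (pos (F n)) ≤ ε :=
          ENNReal.toReal_le_of_le_ofReal hεpos.le (hn μ hμ).le
        push_cast at c1
        linarith)
      have hs : tle α (cls α (ind (pos (F n)) (pos_clopen _))) (cls α g₁) := by
        rw [(cls_eq_iff α _ _).2 r']
        exact tle_refl' _
      rw [hu', add_nsmul, one_nsmul, cls_add, cls_add]
      exact tle_add' ht hs
  have hfin := key M (G n) hGM (by
    intro μ hμ
    have : IsProbabilityMeasure μ := hμ.1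
    rw [hεM]
    have c1 := hgap μ hμ
    rw [e1, e2, II_add, II_add, II_RR (hinvM μ hμ) r] at c1
    have := II_nonneg μ (F n)
    linarith)
  rw [e1, e2, cls_add, cls_add, (cls_eq_iff α h h').2 r]
  exact tle_add' (tle_trans' (tle_of_le (le_ind_pos hFM)) hfin) (tle_refl' _)

end Part4

/-- Let `Γ` be a countable amenable group and `α` an action of `Γ` by
homeomorphisms on a nonempty compact Hausdorff `0`-dimensional space `X`. Then `α` has
dynamical comparison iff for every order unit `b ∈ T(α)`, every `a ∈ T(α)` and every
`n ∈ ℕ` with `(n+1)a ≤ nb`, one has `a ≤ b`. -/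
theorem stmt6 {Γ : Type*} [Group Γ] [Countable Γ]
    {X : Type*} [TopologicalSpace X] [CompactSpace X] [T2Space X]
    [TotallyDisconnectedSpace X] [Nonempty X]
    (hamen : ∃ m : Set Γ → ℝ, IsInvFapm m)
    (α : Γ →* (X ≃ₜ X)) :
    DynComparison α ↔
      ∀ b : TypeSemigroup α, IsOrderUnit α b →
        ∀ (a : TypeSemigroup α) (n : ℕ), tle α ((n + 1) • a) (n • b) → tle α a b := by
  exact ⟨fun H b hb a n h => unperf_of_comparison hamen α H b hb a n h, fun H => comparison_of_unperf hamen α H⟩
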